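/- Consider the COVID-19 model without lockdown. Let (S,E,A,I,C,R) : ℝ → ℝ^6 be differentiable functions on [0,∞) satisfying the system, and suppose N(t) − C(t) > 0 for all t ≥ 0. If S(0) ≥ 0, E(0) ≥ 0, A(0) ≥ 0, I(0) ≥ 0, C(0) ≥ 0, R(0) ≥ 0, then all six components remain nonnegative for all t ≥ 0; that is, the nonnegative orthant ℝ₊^6 is invariant for the system. -/

import Mathlib

lemma hasDerivAt_negsq (x : ℝ) : HasDerivAt (fun x : ℝ => (min x 0) ^ 2) (2 * min x 0) x := by
  rcases lt_trichotomy x 0 with h | h | h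
  · have h1 : HasDerivAt (fun x : ℝ => x ^ 2) (2 * x) x := by
      simpa using hasDerivAt_pow 2 x
    rw [min_eq_left h.le]
    refine h1.congr_of_eventuallyEq ?_
    filter_upwards [Iio_mem_nhds h] with y hy
    rw [min_eq_left (le_of_lt hy)]
  · subst h
    rw [hasDerivAt_iff_isLittleO]
    have h2 : (fun y : ℝ => y ^ 2) =o[nhds 0] (fun y : ℝ => y) := by
      simpa using Asymptotics.isLittleO_pow_pow (𝕜 := ℝ) (show 1 < 2 by norm_num)
    refine Asymptotics.IsBigO.trans_isLittleO (g := fun y : ℝ => y ^ 2) ?_ (by simpa using h2)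
    refine Asymptotics.IsBigO.of_bound 1 (Filter.Eventually.of_forall fun y => ?_)
    rcases le_total y 0 with hy | hy <;> simp [hy]
  · rw [min_eq_right h.le, mul_zero]
    refine (hasDerivAt_const x (0:ℝ)).congr_of_eventuallyEq ?_
    filter_upwards [Ioi_mem_nhds h] with y hy
    rw [min_eq_right (le_of_lt hy)]
    simp

lemma negsq_comp {f : ℝ → ℝ} {f' t : ℝ} (h : HasDerivAt f f' t) :
    HasDerivAt (fun t => (min (f t) 0) ^ 2) (2 * min (f t) 0 * f') t :=
  (hasDerivAt_negsq (f t)).comp t h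

lemma gronwall_zero {V V' : ℝ → ℝ} {T K : ℝ} (hT : 0 ≤ T) (h0 : V 0 = 0)
    (hV : ∀ t ≥ (0:ℝ), HasDerivAt V (V' t) t)
    (hb : ∀ t ∈ Set.Icc 0 T, V' t ≤ K * V t) : V T ≤ 0 := by
  have hd : ∀ t ≥ (0:ℝ), HasDerivAt (fun t => V t * Real.exp (-K * t))
      (V' t * Real.exp (-K * t) + V t * (Real.exp (-K * t) * (-K))) t := by
    intro t ht
    refine (hV t ht).mul (HasDerivAt.exp ?_)
    have h := (hasDerivAt_id' t).const_mul (-K)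
    rwa [mul_one] at h
  have hanti : AntitoneOn (fun t => V t * Real.exp (-K * t)) (Set.Icc 0 T) := by
    refine antitoneOn_of_deriv_nonpos (convex_Icc 0 T)
      (fun t ht => (hd t ht.1).continuousAt.continuousWithinAt) ?_ ?_
    · intro t ht
      rw [interior_Icc] at ht
      exact (hd t ht.1.le).differentiableAt.differentiableWithinAt
    · intro t ht
      rw [interior_Icc] at ht
      rw [(hd t ht.1.le).deriv]
      have := hb t ⟨ht.1.le, ht.2.le⟩
      have he := Real.exp_pos (-K * t)
      nlinarith
  have := hanti (Set.left_mem_Icc.2 hT) (Set.right_mem_Icc.2 hT) hT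
  simp only [h0, zero_mul] at this
  have he := Real.exp_pos (-K * T)
  by_contra hc
  push Not at hc
  nlinarith [mul_pos hc he]

lemma nonneg_of_negsq {x : ℝ} (h : (min x 0) ^ 2 ≤ 0) : 0 ≤ x := by
  have : min x 0 = 0 := by
    have := le_antisymm h (sq_nonneg _)
    simpa using this
  exact min_eq_right_iff.1 this

lemma min_mul_self (x : ℝ) : min x 0 * x = (min x 0) ^ 2 := by
  rcases le_total x 0 with hx | hx <;> simp [hx, sq]

lemma scalar_nonneg {f g a : ℝ → ℝ} (h0 : 0 ≤ f 0)
    (hf : ∀ t ≥ (0:ℝ), HasDerivAt f (g t - a t * f t) t)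
    (hg : ∀ t ≥ (0:ℝ), 0 ≤ g t) (ha : ContinuousOn a (Set.Ici 0)) :
    ∀ t ≥ (0:ℝ), 0 ≤ f t := by
  intro T hT
  obtain ⟨K, hK⟩ := isCompact_Icc.exists_bound_of_continuousOn
    (ha.mono (Set.Icc_subset_Ici_self : Set.Icc 0 T ⊆ Set.Ici 0))
  apply nonneg_of_negsq
  refine gronwall_zero (V := fun t => (min (f t) 0) ^ 2) (K := 2 * K) hT (by simp [h0])
    (fun t ht => negsq_comp (hf t ht)) ?_
  intro t ht
  have h1 := hg t ht.1
  have h2 := abs_le.1 (hK t ht)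
  have h3 := min_mul_self (f t)
  have h4 : min (f t) 0 ≤ 0 := min_le_right _ _
  have h5 : 2 * min (f t) 0 * (g t - a t * f t)
      = 2 * (min (f t) 0 * g t) - 2 * a t * (min (f t) 0) ^ 2 := by
    rw [← h3]; ring
  show _ ≤ 2 * K * (min (f t) 0) ^ 2
  rw [h5]
  nlinarith [mul_nonneg (sub_nonneg.2 h4) h1, mul_nonneg (by linarith : 0 ≤ K + a t) (sq_nonneg (min (f t) 0))]

lemma eai_bound {μ σ γ1 γ2 τ ρ κ b B m n p e x y : ℝ}
    (hμ : 0 < μ) (hσ : 0 < σ) (hγ1 : 0 < γ1) (hγ2 : 0 < γ2) (hτ : 0 < τ)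
    (hρ0 : 0 ≤ ρ) (hρ1 : ρ ≤ 1) (hκ0 : 0 < κ) (hκ1 : κ < 1) (hb0 : 0 ≤ b) (hbB : b ≤ B)
    (mE : m * e = m ^ 2) (mA : n * x = n ^ 2) (mI : p * y = p ^ 2)
    (zE : m ≤ 0) (zA : n ≤ 0) (zI : p ≤ 0) (lE : m ≤ e) (lA : n ≤ x) (lI : p ≤ y) :
    2 * m * (b * y + b * (ρ * x) - (μ + σ) * e)
      + 2 * n * ((1 - κ) * σ * e - (γ1 + μ) * x)
      + 2 * p * (κ * σ * e - (γ2 + τ + μ) * y) ≤ 2 * (B + σ) * (m ^ 2 + n ^ 2 + p ^ 2) := by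
  have k1 : b * (m * y) ≤ b * (m * p) :=
    mul_le_mul_of_nonneg_left (mul_le_mul_of_nonpos_left lI zE) hb0
  have k2 : b * ρ * (m * x) ≤ b * ρ * (m * n) :=
    mul_le_mul_of_nonneg_left (mul_le_mul_of_nonpos_left lA zE) (mul_nonneg hb0 hρ0)
  have k3 : (1 - κ) * σ * (n * e) ≤ (1 - κ) * σ * (n * m) :=
    mul_le_mul_of_nonneg_left (mul_le_mul_of_nonpos_left lE zA)
      (mul_nonneg (by linarith) hσ.le)
  have k4 : κ * σ * (p * e) ≤ κ * σ * (p * m) :=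
    mul_le_mul_of_nonneg_left (mul_le_mul_of_nonpos_left lE zI) (by positivity)
  have mp : 0 ≤ m * p := mul_nonneg_of_nonpos_of_nonpos zE zI
  have mn : 0 ≤ m * n := mul_nonneg_of_nonpos_of_nonpos zE zA
  have j1 : b * (m * p) ≤ B * (m * p) := mul_le_mul_of_nonneg_right hbB mp
  have j2 : b * ρ * (m * n) ≤ B * (m * n) :=
    mul_le_mul_of_nonneg_right (by nlinarith) mn
  have j3 : (1 - κ) * σ * (n * m) ≤ σ * (m * n) := by
    rw [mul_comm n m]; exact mul_le_mul_of_nonneg_right (by nlinarith) mn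
  have j4 : κ * σ * (p * m) ≤ σ * (m * p) := by
    rw [mul_comm p m]; exact mul_le_mul_of_nonneg_right (by nlinarith) mp
  have q : m * p + m * n ≤ m ^ 2 + n ^ 2 + p ^ 2 := by
    nlinarith [sq_nonneg (m - p), sq_nonneg (m - n), sq_nonneg n, sq_nonneg p]
  have q' : (B + σ) * (m * p + m * n) ≤ (B + σ) * (m ^ 2 + n ^ 2 + p ^ 2) :=
    mul_le_mul_of_nonneg_left q (by linarith)
  have d1 : 0 ≤ (μ + σ) * m ^ 2 := by positivity
  have d2 : 0 ≤ (γ1 + μ) * n ^ 2 := by positivity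
  have d3 : 0 ≤ (γ2 + τ + μ) * p ^ 2 := by positivity
  have expand : 2 * m * (b * y + b * (ρ * x) - (μ + σ) * e)
      + 2 * n * ((1 - κ) * σ * e - (γ1 + μ) * x)
      + 2 * p * (κ * σ * e - (γ2 + τ + μ) * y)
      = 2 * (b * (m * y) + b * ρ * (m * x) + (1 - κ) * σ * (n * e)
        + κ * σ * (p * e) - (μ + σ) * m ^ 2 - (γ1 + μ) * n ^ 2
        - (γ2 + τ + μ) * p ^ 2) := by
    linear_combination (-2 * (μ + σ)) * mE - 2 * (γ1 + μ) * mA - 2 * (γ2 + τ + μ) * mI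
  rw [expand]
  linarith

/-- Positivity of solutions for the COVID-19 model without lockdown:
the nonnegative orthant `ℝ₊^6` is invariant. -/
theorem stmt_1
    (PiH μ β1 σ γ1 γ2 γ3 τ δ ρ κ : ℝ)
    (hPiH : 0 < PiH) (hμ : 0 < μ) (hβ1 : 0 < β1) (hσ : 0 < σ)
    (hγ1 : 0 < γ1) (hγ2 : 0 < γ2) (hγ3 : 0 < γ3) (hτ : 0 < τ)
    (hδ : 0 < δ)
    (hρ0 : 0 ≤ ρ) (hρ1 : ρ ≤ 1) (hκ0 : 0 < κ) (hκ1 : κ < 1)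
    (S E A I C R N : ℝ → ℝ)
    (hN : ∀ t, N t = S t + E t + A t + I t + C t + R t)
    (hpos : ∀ t ≥ (0:ℝ), 0 < N t - C t)
    (hS : ∀ t ≥ (0:ℝ), HasDerivAt S (PiH
      - β1 * I t * S t / (N t - C t)
      - ρ * β1 * A t * S t / (N t - C t) - μ * S t) t)
    (hE : ∀ t ≥ (0:ℝ), HasDerivAt E (β1 * I t * S t / (N t - C t)
      + ρ * β1 * A t * S t / (N t - C t) - (μ + σ) * E t) t)
    (hA : ∀ t ≥ (0:ℝ), HasDerivAt A ((1 - κ) * σ * E t - (γ1 + μ) * A t) t)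
    (hI : ∀ t ≥ (0:ℝ), HasDerivAt I (κ * σ * E t - (γ2 + τ + μ) * I t) t)
    (hC : ∀ t ≥ (0:ℝ), HasDerivAt C (τ * I t - (δ + γ3 + μ) * C t) t)
    (hR : ∀ t ≥ (0:ℝ), HasDerivAt R (γ1 * A t + γ2 * I t + γ3 * C t - μ * R t) t)
    (hS0 : 0 ≤ S 0) (hE0 : 0 ≤ E 0) (hA0 : 0 ≤ A 0)
    (hI0 : 0 ≤ I 0) (hC0 : 0 ≤ C 0) (hR0 : 0 ≤ R 0) :
    ∀ t ≥ (0:ℝ), 0 ≤ S t ∧ 0 ≤ E t ∧ 0 ≤ A t ∧ 0 ≤ I t ∧ 0 ≤ C t ∧ 0 ≤ R t := by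
  have cS : ContinuousOn S (Set.Ici 0) := fun t ht => (hS t ht).continuousAt.continuousWithinAt
  have cE : ContinuousOn E (Set.Ici 0) := fun t ht => (hE t ht).continuousAt.continuousWithinAt
  have cA : ContinuousOn A (Set.Ici 0) := fun t ht => (hA t ht).continuousAt.continuousWithinAt
  have cI : ContinuousOn I (Set.Ici 0) := fun t ht => (hI t ht).continuousAt.continuousWithinAt
  have cC : ContinuousOn C (Set.Ici 0) := fun t ht => (hC t ht).continuousAt.continuousWithinAt
  have cR : ContinuousOn R (Set.Ici 0) := fun t ht => (hR t ht).continuousAt.continuousWithinAt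
  have cD : ContinuousOn (fun t => N t - C t) (Set.Ici 0) := by
    simp only [hN]
    fun_prop
  have hD : ∀ t ∈ Set.Ici (0:ℝ), N t - C t ≠ 0 := fun t ht => (hpos t ht).ne'
  have nS : ∀ t ≥ (0:ℝ), 0 ≤ S t := by
    refine scalar_nonneg (g := fun _ => PiH)
      (a := fun t => (β1 * I t + ρ * β1 * A t) / (N t - C t) + μ) hS0 ?_ (fun _ _ => hPiH.le) ?_
    · intro t ht
      convert hS t ht using 1
      ring
    · exact (ContinuousOn.div (by fun_prop) cD hD).add continuousOn_const
  have cb : ContinuousOn (fun t => β1 * S t / (N t - C t)) (Set.Ici 0) :=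
    ContinuousOn.div (by fun_prop) cD hD
  have nEAI : ∀ t ≥ (0:ℝ), 0 ≤ E t ∧ 0 ≤ A t ∧ 0 ≤ I t := by
    intro T hT
    obtain ⟨B, hB⟩ := isCompact_Icc.exists_bound_of_continuousOn
      (cb.mono (Set.Icc_subset_Ici_self : Set.Icc 0 T ⊆ Set.Ici 0))
    have key := gronwall_zero
      (V := fun t => (min (E t) 0) ^ 2 + (min (A t) 0) ^ 2 + (min (I t) 0) ^ 2)
      (K := 2 * (B + σ)) hT (by simp [hE0, hA0, hI0])
      (fun t ht => ((negsq_comp (hE t ht)).add (negsq_comp (hA t ht))).add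
        (negsq_comp (hI t ht))) ?_
    · have e1 := sq_nonneg (min (E T) 0)
      have e2 := sq_nonneg (min (A T) 0)
      have e3 := sq_nonneg (min (I T) 0)
      exact ⟨nonneg_of_negsq (by linarith), nonneg_of_negsq (by linarith),
        nonneg_of_negsq (by linarith)⟩
    · intro t ht
      have hb0 : 0 ≤ β1 * S t / (N t - C t) :=
        div_nonneg (mul_nonneg hβ1.le (nS t ht.1)) (hpos t ht.1).le
      have hbB : β1 * S t / (N t - C t) ≤ B := (abs_le.1 (hB t ht)).2
      have r1 : β1 * I t * S t / (N t - C t) = β1 * S t / (N t - C t) * I t := by ring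
      have r2 : ρ * β1 * A t * S t / (N t - C t) = β1 * S t / (N t - C t) * (ρ * A t) := by ring
      rw [r1, r2]
      generalize β1 * S t / (N t - C t) = b at hb0 hbB
      have mE := min_mul_self (E t)
      have mA := min_mul_self (A t)
      have mI := min_mul_self (I t)
      have zE : min (E t) 0 ≤ 0 := min_le_right _ _
      have zA : min (A t) 0 ≤ 0 := min_le_right _ _
      have zI : min (I t) 0 ≤ 0 := min_le_right _ _
      have lE : min (E t) 0 ≤ E t := min_le_left _ _
      have lA : min (A t) 0 ≤ A t := min_le_left _ _
      have lI : min (I t) 0 ≤ I t := min_le_left _ _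
      show _ ≤ 2 * (B + σ) * ((min (E t) 0) ^ 2 + (min (A t) 0) ^ 2 + (min (I t) 0) ^ 2)
      exact eai_bound hμ hσ hγ1 hγ2 hτ hρ0 hρ1 hκ0 hκ1 hb0 hbB mE mA mI zE zA zI lE lA lI
  have nC : ∀ t ≥ (0:ℝ), 0 ≤ C t :=
    scalar_nonneg (g := fun t => τ * I t) (a := fun _ => δ + γ3 + μ) hC0 hC
      (fun t ht => mul_nonneg hτ.le (nEAI t ht).2.2) continuousOn_const
  have nR : ∀ t ≥ (0:ℝ), 0 ≤ R t := by
    refine scalar_nonneg (g := fun t => γ1 * A t + γ2 * I t + γ3 * C t) (a := fun _ => μ) hR0 hR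
      (fun t ht => ?_) continuousOn_const
    have h1 := mul_nonneg hγ1.le (nEAI t ht).2.1
    have h2 := mul_nonneg hγ2.le (nEAI t ht).2.2
    have h3 := mul_nonneg hγ3.le (nC t ht)
    show 0 ≤ γ1 * A t + γ2 * I t + γ3 * C t
    linarith
  intro t ht
  obtain ⟨h1, h2, h3⟩ := nEAI t ht
  exact ⟨nS t ht, h1, h2, h3, nC t ht, nR t ht⟩
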